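/- Let m > 2d+3 and let T, T' be triangulations of C(m,2d) such that T <₂ T' (i.e. T ≤₂ T' and T ≠ T'), T[1→2] = T'[1→2], and T[m−1←m] = T'[m−1←m]. Then there exists v with 3 ≤ v ≤ m−2 such that, under the order isomorphism [m] ≅ [m−1]_{v+} which fixes {1,…,v−1}, sends v ↦ x and v+1 ↦ y, and sends i ↦ i−1 for i ≥ v+2, the triangulations T̂, T̂' of C([m−1]_{v+},2d) corresponding to T, T' satisfy T̂[x→v←y] <₂ T̂'[x→v←y] as triangulations of C(m−1,2d). -/

import Mathlib

open scoped Classical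

namespace HST

/-- `AltChain l₁ l₂` holds when the alternating merge of the two lists, starting with the
head of `l₁`, is strictly increasing: `a₀ < b₀ < a₁ < b₁ < ⋯`.  The lengths must satisfy
`l₂.length ≤ l₁.length ≤ l₂.length + 1`. -/
def AltChain : List ℚ → List ℚ → Prop
  | [], [] => True
  | [], _ :: _ => False
  | [_], [] => True
  | _ :: _ :: _, [] => False
  | a :: as, b :: bs => a < b ∧ AltChain (b :: bs) as
termination_by l₁ l₂ => l₁.length + l₂.length
decreasing_by simp; omega

/-- The alternating merge starting with the least element of `A`. -/
def Intertwines (A B : Finset ℚ) : Prop :=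
  AltChain (A.sort (· ≤ ·)) (B.sort (· ≤ ·))

/-- The paper's intertwining relation `A ≀ B`: for `#A = #B = k + 1` it means
`a₀ < b₀ < a₁ < b₁ < ⋯ < a_k < b_k`; for `#A = #B - 1` it means
`b₀ < a₀ < b₁ < a₁ < ⋯ < b_k`. -/
def Wr (A B : Finset ℚ) : Prop :=
  if A.card = B.card then Intertwines A B else Intertwines B A

/-- Gale's evenness criterion: upper facets of the cyclic polytope with vertex set `V`. -/
def IsUpperFacet (V : Finset ℚ) (n : ℕ) (F : Finset ℚ) : Prop :=
  F ⊆ V ∧ F.card = n ∧ ∀ w ∈ V \ F, Odd ((F.filter fun x => w < x).card)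

/-- Gale's evenness criterion: lower facets of the cyclic polytope with vertex set `V`. -/
def IsLowerFacet (V : Finset ℚ) (n : ℕ) (F : Finset ℚ) : Prop :=
  F ⊆ V ∧ F.card = n ∧ ∀ w ∈ V \ F, Even ((F.filter fun x => w < x).card)

def IsFacet (V : Finset ℚ) (n : ℕ) (F : Finset ℚ) : Prop :=
  IsUpperFacet V n F ∨ IsLowerFacet V n F

/-- The circuits of the cyclic polytope `C(V, n)`. -/
def IsCircuit (V : Finset ℚ) (n : ℕ) (Zp Zm : Finset ℚ) : Prop :=
  Zp ⊆ V ∧ Zm ⊆ V ∧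
    ((Zp.card = n / 2 + 1 ∧ Zm.card = (n + 1) / 2 + 1 ∧ Wr Zp Zm) ∨
      (Zm.card = n / 2 + 1 ∧ Zp.card = (n + 1) / 2 + 1 ∧ Wr Zm Zp))

/-- Combinatorial triangulations of the cyclic polytope `C(V, n)`. -/
def IsTriangulation (V : Finset ℚ) (n : ℕ) (T : Finset (Finset ℚ)) : Prop :=
  (∀ S ∈ T, S ⊆ V ∧ S.card = n + 1) ∧
    (∀ S ∈ T, ∀ F ⊆ S, F.card = n →
      (∃ G, IsFacet V n G ∧ F ⊆ G) ∨ ∃ R ∈ T, R ≠ S ∧ F ⊆ R) ∧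
    (∀ S ∈ T, ∀ R ∈ T, ∀ Zp Zm, IsCircuit V n Zp Zm → ¬(Zp ⊆ S ∧ Zm ⊆ R))

noncomputable def lowerFacets (V : Finset ℚ) (n : ℕ) : Finset (Finset ℚ) :=
  V.powerset.filter fun F => IsLowerFacet V n F

noncomputable def upperFacets (V : Finset ℚ) (n : ℕ) : Finset (Finset ℚ) :=
  V.powerset.filter fun F => IsUpperFacet V n F

/-- `T'` is an increasing bistellar flip of `T`. -/
def IsIncFlip (V : Finset ℚ) (n : ℕ) (T T' : Finset (Finset ℚ)) : Prop :=
  ∃ U, U ⊆ V ∧ U.card = n + 2 ∧ lowerFacets U (n + 1) ⊆ T ∧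
    T' = (T \ lowerFacets U (n + 1)) ∪ upperFacets U (n + 1)

/-- The first higher Stasheff–Tamari order. -/
def Le1 (V : Finset ℚ) (n : ℕ) : Finset (Finset ℚ) → Finset (Finset ℚ) → Prop :=
  Relation.ReflTransGen (IsIncFlip V n)

/-- `simp(T)`: the internal `⌊n/2⌋`-simplices of a triangulation `T` of `C(V, n)`. -/
noncomputable def internalSimps (V : Finset ℚ) (n : ℕ) (T : Finset (Finset ℚ)) :
    Finset (Finset ℚ) :=
  V.powerset.filter fun A =>
    A.card = n / 2 + 1 ∧ (∃ S ∈ T, A ⊆ S) ∧ ∀ F, IsFacet V n F → ¬A ⊆ F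

/-- The second higher Stasheff–Tamari order in even dimension `n = 2d`. -/
def Le2Even (V : Finset ℚ) (d : ℕ) (T T' : Finset (Finset ℚ)) : Prop :=
  ∀ A ∈ internalSimps V (2 * d) T, ∀ B ∈ internalSimps V (2 * d) T', ¬Wr B A

/-- The second higher Stasheff–Tamari order in odd dimension `n = 2d + 1`. -/
def Le2Odd (V : Finset ℚ) (d : ℕ) (T T' : Finset (Finset ℚ)) : Prop :=
  internalSimps V (2 * d + 1) T' ⊆ internalSimps V (2 * d + 1) T

/-- The second higher Stasheff–Tamari order. -/
def Le2 (V : Finset ℚ) (n : ℕ) (T T' : Finset (Finset ℚ)) : Prop :=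
  if Even n then ∀ A ∈ internalSimps V n T, ∀ B ∈ internalSimps V n T', ¬Wr B A
  else internalSimps V n T' ⊆ internalSimps V n T

/-- The vertex set `[m] = {1, …, m}`, realised inside `ℚ`. -/
noncomputable def vSet (m : ℕ) : Finset ℚ := (Finset.Icc 1 m).image fun i => (i : ℚ)

/-- `C(U, n)` is a subpolytope of the triangulation `T`. -/
def IsSubpolytope (n : ℕ) (T : Finset (Finset ℚ)) (U : Finset ℚ) : Prop :=
  IsTriangulation U n (T.filter fun S => S ⊆ U)

/-- Contraction of a triangulation along a vertex map `c`. -/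
noncomputable def contractTri (c : ℚ → ℚ) (n : ℕ) (T : Finset (Finset ℚ)) :
    Finset (Finset ℚ) :=
  (T.image fun S => S.image c).filter fun S => S.card = n + 1

/-- The vertex map of the contraction `[m - 1 ← m]`. -/
def topMap (m : ℚ) (a : ℚ) : ℚ := if a = m then m - 1 else a

/-- The vertex map of the contraction `[1 → 2]`. -/
def botMap (a : ℚ) : ℚ := if a = 1 then 2 else a

/-- The vertex `x` of `[N]_{v+}`, realised in `ℚ`. -/
def xOf (v : ℕ) : ℚ := (v : ℚ) - 1/3

/-- The vertex `y` of `[N]_{v+}`, realised in `ℚ`. -/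
def yOf (v : ℕ) : ℚ := (v : ℚ) + 1/3

/-- The vertex set `[N]_{v+} = {1, …, v - 1, x, y, v + 1, …, N}`. -/
noncomputable def vPlus (N v : ℕ) : Finset ℚ :=
  insert (xOf v) (insert (yOf v) ((vSet N).erase (v : ℚ)))

/-- The vertex map of the contraction `[x → v ← y]`. -/
def midMap (v : ℕ) (a : ℚ) : ℚ := if a = xOf v ∨ a = yOf v then (v : ℚ) else a

/-- `U_{v+}` for a subset `U` of `[N]`. -/
noncomputable def setVPlus (v : ℕ) (U : Finset ℚ) : Finset ℚ :=
  if (v : ℚ) ∈ U then insert (xOf v) (insert (yOf v) (U.erase (v : ℚ))) else U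

/-- `I(m, d)`: the internal `d`-simplices of `C(m, 2d)`. -/
noncomputable def Iset (m d : ℕ) : Finset (Finset ℚ) :=
  (vSet m).powerset.filter fun A =>
    A.card = d + 1 ∧ (∀ a ∈ A, a + 1 ∉ A) ∧ ¬((1 : ℚ) ∈ A ∧ (m : ℚ) ∈ A)

/-- `O(m, d)`: the internal `d`-simplices of `C(m, 2d + 1)`. -/
noncomputable def Oset (m d : ℕ) : Finset (Finset ℚ) :=
  (Iset m d).filter fun A => (1 : ℚ) ∉ A ∧ (m : ℚ) ∉ A


/-- The order isomorphism `[m] ≅ [m-1]_{v+}` fixing `{1, …, v-1}`, sending `v ↦ x`,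
`v + 1 ↦ y`, and `i ↦ i - 1` for `i ≥ v + 2`. -/
def relabel (v : ℕ) (a : ℚ) : ℚ :=
  if a < (v : ℚ) then a
  else if a = (v : ℚ) then xOf v
  else if a = (v : ℚ) + 1 then yOf v
  else a - 1

/-! ### Alternating splittings and circuits -/

mutual
/-- The entries of a list in even positions. -/
def evenPart : List ℚ → List ℚ
  | [] => []
  | a :: l => a :: oddPart l
/-- The entries of a list in odd positions. -/
def oddPart : List ℚ → List ℚ
  | [] => []
  | _ :: l => evenPart l
end

theorem evenPart_oddPart_sublist (l : List ℚ) :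
    (evenPart l).Sublist l ∧ (oddPart l).Sublist l := by
  induction l with
  | nil => simp [evenPart, oddPart]
  | cons a l ih =>
    simp only [evenPart, oddPart]
    exact ⟨ih.2.cons_cons a, ih.1.cons a⟩

theorem length_evenPart_oddPart (l : List ℚ) :
    (evenPart l).length = (l.length + 1) / 2 ∧ (oddPart l).length = l.length / 2 := by
  induction l with
  | nil => simp [evenPart, oddPart]
  | cons a l ih =>
    simp only [evenPart, oddPart, List.length_cons]
    omega

theorem mem_evenPart_or_mem_oddPart {l : List ℚ} {x : ℚ} (hx : x ∈ l) :
    x ∈ evenPart l ∨ x ∈ oddPart l := by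
  induction l with
  | nil => simp at hx
  | cons a l ih =>
    simp only [evenPart, oddPart, List.mem_cons] at hx ⊢
    tauto

theorem altChain_evenPart_oddPart (l : List ℚ) (hl : l.Pairwise (· < ·)) :
    AltChain (evenPart l) (oddPart l) := by
  induction l with
  | nil => simp [evenPart, oddPart, AltChain]
  | cons a l ih =>
    cases l with
    | nil => simp [evenPart, oddPart, AltChain]
    | cons b l =>
      have h := ih hl.of_cons
      simp only [evenPart, oddPart, AltChain] at h ⊢
      exact ⟨List.rel_of_pairwise_cons hl (by simp), h⟩

theorem exists_between_of_mem_parts (l : List ℚ) (hl : l.Pairwise (· < ·)) {x y : ℚ} (hxy : x < y) :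
    (x ∈ evenPart l → y ∈ evenPart l → ∃ z ∈ l, x < z ∧ z < y) ∧
      (x ∈ oddPart l → y ∈ oddPart l → ∃ z ∈ l, x < z ∧ z < y) := by
  induction l with
  | nil => simp [evenPart, oddPart]
  | cons a l ih =>
    obtain ⟨ih₁, ih₂⟩ := ih hl.of_cons
    have lift : (∃ z ∈ l, x < z ∧ z < y) → ∃ z ∈ a :: l, x < z ∧ z < y := by
      rintro ⟨z, hz, h⟩
      exact ⟨z, List.mem_cons_of_mem _ hz, h⟩
    refine ⟨fun hx hy => ?_, fun hx hy => lift (ih₁ hx hy)⟩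
    simp only [evenPart, List.mem_cons] at hx hy
    have mem_l : ∀ w ∈ oddPart l, w ∈ l := fun w hw => (evenPart_oddPart_sublist l).2.subset hw
    rcases hx with rfl | hx
    · rcases hy with rfl | hy
      · exact absurd hxy (lt_irrefl _)
      · cases l with
        | nil => simp [oddPart] at hy
        | cons b l =>
          refine ⟨b, by simp, List.rel_of_pairwise_cons hl (by simp), ?_⟩
          exact List.rel_of_pairwise_cons hl.of_cons
            ((evenPart_oddPart_sublist l).1.subset (by simpa [oddPart] using hy))
    · rcases hy with rfl | hy
      · exact absurd hxy (List.rel_of_pairwise_cons hl (mem_l x hx)).not_gt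
      · exact lift (ih₂ hx hy)

theorem sort_toFinset_of_pairwise_lt {l : List ℚ} (hl : l.Pairwise (· < ·)) :
    l.toFinset.sort (· ≤ ·) = l :=
  (List.toFinset_sort (r := (· ≤ ·)) (hl.imp ne_of_lt)).2 (hl.imp le_of_lt)

/-- A `2k`-set splits into two intertwining `k`-sets, and two elements of the set with nothing
of the set in between lie in different halves. -/
theorem exists_intertwines_split (U : Finset ℚ) (k : ℕ) (hU : U.card = 2 * k) :
    ∃ A B : Finset ℚ, A ⊆ U ∧ B ⊆ U ∧ A.card = k ∧ B.card = k ∧ Intertwines A B ∧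
      ∀ x ∈ U, ∀ y ∈ U, x < y → (∀ z ∈ U, ¬(x < z ∧ z < y)) →
        (y ∉ A ∧ x ∉ B) ∨ (y ∉ B ∧ x ∉ A) := by
  have hs : (U.sort (· ≤ ·)).Pairwise (· < ·) := (U.sortedLT_sort).pairwise
  set l := U.sort (· ≤ ·) with hl
  have hlen : l.length = 2 * k := by simp [hl, hU]
  have hmem : ∀ x, x ∈ l ↔ x ∈ U := by simp [hl]
  obtain ⟨sE, sO⟩ := evenPart_oddPart_sublist l
  obtain ⟨lE, lO⟩ := length_evenPart_oddPart l
  have pE := hs.sublist sE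
  have pO := hs.sublist sO
  refine ⟨(evenPart l).toFinset, (oddPart l).toFinset, ?_, ?_, ?_, ?_, ?_, ?_⟩
  · intro x hx
    exact (hmem x).1 (sE.subset (by simpa using hx))
  · intro x hx
    exact (hmem x).1 (sO.subset (by simpa using hx))
  · rw [List.toFinset_card_of_nodup (pE.imp ne_of_lt)]
    omega
  · rw [List.toFinset_card_of_nodup (pO.imp ne_of_lt)]
    omega
  · rw [Intertwines, sort_toFinset_of_pairwise_lt pE, sort_toFinset_of_pairwise_lt pO]
    exact altChain_evenPart_oddPart l hs
  · intro x hx y hy hxy hno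
    obtain ⟨hE, hO⟩ := exists_between_of_mem_parts l hs hxy
    have hno' : ¬∃ z ∈ l, x < z ∧ z < y := by
      rintro ⟨z, hz, h⟩
      exact hno z ((hmem z).1 hz) h
    simp only [List.mem_toFinset]
    rcases mem_evenPart_or_mem_oddPart ((hmem x).2 hx) with hxE | hxO
    · have hyE : y ∉ evenPart l := fun h => hno' (hE hxE h)
      have hyO := (mem_evenPart_or_mem_oddPart ((hmem y).2 hy)).resolve_left hyE
      exact Or.inl ⟨hyE, fun hxO => hno' (hO hxO hyO)⟩
    · have hyO : y ∉ oddPart l := fun h => hno' (hO hxO h)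
      have hyE := (mem_evenPart_or_mem_oddPart ((hmem y).2 hy)).resolve_right hyO
      exact Or.inr ⟨hyO, fun hxE => hno' (hE hxE hyE)⟩

theorem vSet_eq_image (m : ℕ) : vSet m = (Finset.Icc 1 m).image (Nat.cast : ℕ → ℚ) := by
  ext a
  simp [vSet, Finset.bind_def, eq_comm]

theorem mem_vSet {m : ℕ} {a : ℚ} : a ∈ vSet m ↔ ∃ i : ℕ, 1 ≤ i ∧ i ≤ m ∧ (i : ℚ) = a := by
  simp [vSet_eq_image, and_assoc]

theorem card_vSet (m : ℕ) : (vSet m).card = m := by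
  rw [vSet_eq_image, Finset.card_image_of_injective _ Nat.cast_injective]
  simp

/-- A triangulation does not contain two simplices that differ by a shift of one vertex to the
next one. -/
theorem IsTriangulation.shift_notMem {m d : ℕ} {T : Finset (Finset ℚ)}
    (hT : IsTriangulation (vSet m) (2 * d) T) {S : Finset ℚ} (hS : S ∈ T) {h : ℕ}
    (hh : (h : ℚ) ∉ S) (hh' : (h : ℚ) + 1 ∈ S) : insert (h : ℚ) (S.erase (h + 1)) ∉ T := by
  intro hR
  obtain ⟨hSV, hSc⟩ := hT.1 S hS
  have hRV := (hT.1 _ hR).1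
  have hU : (insert (h : ℚ) S).card = 2 * (d + 1) := by
    rw [Finset.card_insert_of_notMem hh, hSc]
    ring
  have hUV : insert (h : ℚ) S ⊆ vSet m :=
    Finset.insert_subset (hRV (Finset.mem_insert_self _ _)) hSV
  obtain ⟨A, B, hA, hB, hAc, hBc, hAB, hsplit⟩ := exists_intertwines_split _ _ hU
  have hcirc : IsCircuit (vSet m) (2 * d) A B := by
    refine ⟨hA.trans hUV, hB.trans hUV, Or.inl ⟨by omega, by omega, ?_⟩⟩
    rw [Wr, if_pos (hAc.trans hBc.symm)]
    exact hAB
  have sub_S : ∀ Z ⊆ insert (h : ℚ) S, (h : ℚ) ∉ Z → Z ⊆ S := fun Z hZ hn =>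
    (Finset.subset_insert_iff_of_notMem hn).1 hZ
  have sub_R : ∀ Z ⊆ insert (h : ℚ) S, (h : ℚ) + 1 ∉ Z →
      Z ⊆ insert (h : ℚ) (S.erase (h + 1)) := by
    intro Z hZ hn z hz
    have hne : z ≠ h + 1 := fun e => hn (e ▸ hz)
    have := hZ hz
    simp only [Finset.mem_insert, Finset.mem_erase] at this ⊢
    tauto
  rcases hsplit h (Finset.mem_insert_self _ _) (h + 1) (Finset.mem_insert_of_mem hh') (by simp) (by
      rintro z hz ⟨h1, h2⟩
      obtain ⟨i, -, -, rfl⟩ := mem_vSet.1 (hUV hz)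
      norm_cast at h1 h2
      omega) with ⟨h1, h2⟩ | ⟨h1, h2⟩
  · exact hT.2.2 _ hR _ hS A B hcirc ⟨sub_R A hA h1, sub_S B hB h2⟩
  · exact hT.2.2 _ hS _ hR A B hcirc ⟨sub_S A hA h2, sub_R B hB h1⟩

/-! ### Contracting an edge of consecutive vertices -/

/-- On the set `V`, the map `f` identifies `h` with `h + 1` and is otherwise injective. -/
def CollapsesAt (V : Finset ℚ) (f : ℚ → ℚ) (h : ℚ) : Prop :=
  f h = f (h + 1) ∧ ∀ a ∈ V, ∀ b ∈ V, f a = f b → a < b → a = h ∧ b = h + 1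

theorem CollapsesAt.injOn {V : Finset ℚ} {f : ℚ → ℚ} {h : ℚ} (hf : CollapsesAt V f h)
    {S : Finset ℚ} (hSV : S ⊆ V) (hS : h ∉ S ∨ h + 1 ∉ S) : Set.InjOn f S := by
  intro a ha b hb hab
  by_contra hne
  have ha' : a ∈ S := ha
  have hb' : b ∈ S := hb
  rcases lt_or_gt_of_ne hne with hlt | hlt
  · obtain ⟨rfl, rfl⟩ := hf.2 a (hSV ha) b (hSV hb) hab hlt
    tauto
  · obtain ⟨rfl, rfl⟩ := hf.2 b (hSV hb) a (hSV ha) hab.symm hlt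
    tauto

theorem CollapsesAt.eq_or {V : Finset ℚ} {f : ℚ → ℚ} {h : ℚ} (hf : CollapsesAt V f h)
    {a b : ℚ} (ha : a ∈ V) (hb : b ∈ V) (hab : f a = f b) :
    a = b ∨ (a = h ∧ b = h + 1) ∨ (b = h ∧ a = h + 1) := by
  rcases lt_trichotomy a b with hlt | heq | hlt
  · exact Or.inr (Or.inl (hf.2 a ha b hb hab hlt))
  · exact Or.inl heq
  · exact Or.inr (Or.inr (hf.2 b hb a ha hab.symm hlt))

/-- If two triangulations have the same contraction at an edge, every simplex of the first that
misses the lower end of the edge is in the second up to a shift of that edge's vertex. -/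
theorem mem_or_shift_mem {V : Finset ℚ} {n : ℕ} {T T' : Finset (Finset ℚ)} {f : ℚ → ℚ} {h : ℚ}
    (hf : CollapsesAt V f h) (hT : ∀ S ∈ T, S ⊆ V ∧ S.card = n + 1)
    (hT' : ∀ S ∈ T', S ⊆ V ∧ S.card = n + 1) (hc : contractTri f n T = contractTri f n T')
    {S : Finset ℚ} (hS : S ∈ T) (hh : h ∉ S) :
    S ∈ T' ∨ (h + 1 ∈ S ∧ insert h (S.erase (h + 1)) ∈ T') := by
  obtain ⟨hSV, hSc⟩ := hT S hS
  have hmem : S.image f ∈ contractTri f n T := by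
    simp only [contractTri, Finset.mem_filter, Finset.mem_image]
    exact ⟨⟨S, hS, rfl⟩, by rw [Finset.card_image_of_injOn (hf.injOn hSV (Or.inl hh)), hSc]⟩
  rw [hc] at hmem
  simp only [contractTri, Finset.mem_filter, Finset.mem_image] at hmem
  obtain ⟨⟨R, hR, hRS⟩, -⟩ := hmem
  obtain ⟨hRV, hRc⟩ := hT' R hR
  have key : ∀ r ∈ R, ∃ s ∈ S, r = s ∨ (r = h ∧ s = h + 1) := by
    intro r hr
    have : f r ∈ S.image f := hRS ▸ Finset.mem_image_of_mem f hr
    obtain ⟨s, hs, hsr⟩ := Finset.mem_image.1 this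
    refine ⟨s, hs, ?_⟩
    rcases hf.eq_or (hSV hs) (hRV hr) hsr with e | ⟨e, -⟩ | e
    · exact Or.inl e.symm
    · exact absurd (e ▸ hs) hh
    · exact Or.inr e
  by_cases hhR : h ∈ R
  · right
    have hh1 : h + 1 ∈ S := by
      obtain ⟨s, hs, rfl | ⟨-, rfl⟩⟩ := key h hhR
      · exact absurd hs hh
      · exact hs
    have hh1R : h + 1 ∉ R := by
      intro h1
      have hlt : (R.image f).card < R.card := by
        refine Finset.card_image_le.lt_of_ne fun hcard => ?_
        have hinj := Finset.card_image_iff.1 hcard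
        have := hinj hhR h1 hf.1
        linarith
      rw [hRS, Finset.card_image_of_injOn (hf.injOn hSV (Or.inl hh))] at hlt
      omega
    refine ⟨hh1, ?_⟩
    convert hR using 1
    symm
    apply Finset.eq_of_subset_of_card_le
    · intro r hr
      have hne : r ≠ h + 1 := fun e => hh1R (e ▸ hr)
      obtain ⟨s, hs, rfl | ⟨e, -⟩⟩ := key r hr <;> simp_all
    · rw [Finset.card_insert_of_notMem (by simp [hh]), Finset.card_erase_of_mem hh1]
      omega
  · left
    convert hR using 1
    symm
    apply Finset.eq_of_subset_of_card_le
    · intro r hr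
      obtain ⟨s, hs, rfl | ⟨e, -⟩⟩ := key r hr
      · exact hs
      · exact absurd (e ▸ hr) hhR
    · omega

theorem mem_of_not_mem_edge {V : Finset ℚ} {n : ℕ} {T T' : Finset (Finset ℚ)} {f : ℚ → ℚ} {h : ℚ}
    (hf : CollapsesAt V f h) (hT : ∀ S ∈ T, S ⊆ V ∧ S.card = n + 1)
    (hT' : ∀ S ∈ T', S ⊆ V ∧ S.card = n + 1) (hc : contractTri f n T = contractTri f n T')
    {S : Finset ℚ} (hS : S ∈ T) (hh : h ∉ S) (hh' : h + 1 ∉ S) : S ∈ T' :=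
  (mem_or_shift_mem hf hT hT' hc hS hh).resolve_right fun h1 => hh' h1.1

/-- If all contractions along `{h, h + 1}` with `3 ≤ h < m` agree, a simplex on which the two
triangulations disagree misses at most one of the vertices `3, …, m`. -/
theorem mem_of_two_missing {m d : ℕ} {f : ℕ → ℚ → ℚ}
    (hf : ∀ h, 3 ≤ h → h < m → CollapsesAt (vSet m) (f h) h) (k : ℕ) :
    ∀ (T T' : Finset (Finset ℚ)), IsTriangulation (vSet m) (2 * d) T →
      IsTriangulation (vSet m) (2 * d) T' →
      (∀ h, 3 ≤ h → h < m → contractTri (f h) (2 * d) T = contractTri (f h) (2 * d) T') →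
      ∀ (S : Finset ℚ) (h : ℕ), S ∈ T → 3 ≤ h → h + k + 1 ≤ m → (h : ℚ) ∉ S →
        ((h + k + 1 : ℕ) : ℚ) ∉ S → S ∈ T' := by
  induction k with
  | zero =>
    intro T T' hT hT' hc S h hS h3 hm h1 h2
    exact mem_of_not_mem_edge (hf h h3 (by omega)) hT.1 hT'.1 (hc h h3 (by omega)) hS h1
      (by simpa using h2)
  | succ k ih =>
    intro T T' hT hT' hc S h hS h3 hm h1 h2
    rcases mem_or_shift_mem (hf h h3 (by omega)) hT.1 hT'.1 (hc h h3 (by omega)) hS h1 with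
      h' | ⟨hh, h'⟩
    · exact h'
    · refine absurd ?_ (hT.shift_notMem hS h1 hh)
      refine ih T' T hT' hT (fun h h3 hm => (hc h h3 hm).symm) _ (h + 1) h' (by omega) (by omega)
        ?_ ?_
      · push_cast
        simp
      · rw [show h + 1 + k + 1 = h + (k + 1) + 1 by ring, Finset.mem_insert, not_or]
        refine ⟨?_, fun hx => h2 (Finset.mem_of_mem_erase hx)⟩
        norm_cast
        omega

/-- A triangulation is determined by its contractions along `{1, 2}` and along `{h, h + 1}` for
`3 ≤ h < m`. -/
theorem subset_of_contractTri_eq {m d : ℕ} (hm : 2 * d + 3 < m) {f : ℕ → ℚ → ℚ}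
    (hf : ∀ h, 3 ≤ h → h < m → CollapsesAt (vSet m) (f h) h) {g : ℚ → ℚ}
    (hg : CollapsesAt (vSet m) g 1) {T T' : Finset (Finset ℚ)}
    (hT : IsTriangulation (vSet m) (2 * d) T) (hT' : IsTriangulation (vSet m) (2 * d) T')
    (hc : ∀ h, 3 ≤ h → h < m → contractTri (f h) (2 * d) T = contractTri (f h) (2 * d) T')
    (hb : contractTri g (2 * d) T = contractTri g (2 * d) T') : T ⊆ T' := by
  intro S hS
  obtain ⟨hSV, hSc⟩ := hT.1 S hS
  by_cases h12 : (1 : ℚ) ∉ S ∧ (1 : ℚ) + 1 ∉ S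
  · exact mem_of_not_mem_edge hg hT.1 hT'.1 hb hS h12.1 h12.2
  have hholes : ∃ e : ℚ,
      vSet m \ S ⊆ insert e ((Finset.Icc 3 m).image (fun i : ℕ => (i : ℚ)) \ S) := by
    refine ⟨if (1 : ℚ) ∈ S then 2 else 1, fun z hz => ?_⟩
    obtain ⟨hzV, hzS⟩ := Finset.mem_sdiff.1 hz
    obtain ⟨i, h1, h2, rfl⟩ := mem_vSet.1 hzV
    rw [Finset.mem_insert, Finset.mem_sdiff, Finset.mem_image]
    rcases Nat.lt_or_ge i 3 with hi | hi
    · left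
      norm_num at h12
      interval_cases i
      · simp_all
      · have : (1 : ℚ) ∈ S := by
          by_contra h
          exact hzS (by simpa using h12 h)
        simp [this]
    · exact Or.inr ⟨⟨i, by simp [hi, h2], rfl⟩, hzS⟩
  obtain ⟨e, he⟩ := hholes
  have hcard := (Finset.card_le_card he).trans (Finset.card_insert_le _ _)
  rw [Finset.card_sdiff_of_subset hSV, card_vSet, hSc] at hcard
  obtain ⟨a, ha, b, hb, hab⟩ := Finset.one_lt_card.1
    (show 1 < ((Finset.Icc 3 m).image (fun i : ℕ => (i : ℚ)) \ S).card by omega)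
  simp only [Finset.mem_sdiff, Finset.mem_image, Finset.mem_Icc] at ha hb
  obtain ⟨⟨i, ⟨hi3, him⟩, rfl⟩, hiS⟩ := ha
  obtain ⟨⟨j, ⟨hj3, hjm⟩, rfl⟩, hjS⟩ := hb
  have hij : i ≠ j := fun h => hab (by rw [h])
  rcases lt_or_gt_of_ne hij with hlt | hlt
  · obtain ⟨k, rfl⟩ := Nat.exists_eq_add_of_lt hlt
    exact mem_of_two_missing hf k T T' hT hT' hc S i hS hi3 hjm hiS hjS
  · obtain ⟨k, rfl⟩ := Nat.exists_eq_add_of_lt hlt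
    exact mem_of_two_missing hf k T T' hT hT' hc S j hS hj3 him hjS hiS

/-! ### Contractions preserve the second order -/

/-- The monotone map contracting the interval `[v, v + 1]` to `v`. -/
def collapse (v : ℕ) (a : ℚ) : ℚ := if a ≤ v then a else max v (a - 1)

theorem collapse_mono (v : ℕ) : Monotone (collapse v) := by
  intro a b hab
  unfold collapse
  split_ifs with h1 h2
  · exact hab
  · exact h1.trans (le_max_left _ _)
  · linarith
  · exact max_le_max_left _ (by linarith)

theorem collapse_natCast (v i : ℕ) : collapse v i = ((if i ≤ v then i else i - 1 : ℕ) : ℚ) := by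
  unfold collapse
  split_ifs with h1 h2 h2
  · rfl
  · exact absurd (by exact_mod_cast h1) h2
  · exact absurd (by exact_mod_cast h2) h1
  · rw [Nat.cast_sub (by omega), Nat.cast_one, max_eq_right]
    have : (v : ℚ) + 1 ≤ i := by
      exact_mod_cast (show v + 1 ≤ i by omega)
    linarith

theorem collapsesAt_collapse (m v : ℕ) : CollapsesAt (vSet m) (collapse v) v := by
  constructor
  · have := collapse_natCast v (v + 1)
    push_cast at this
    rw [this, collapse_natCast]
    simp
  · intro a ha b hb hab hlt
    obtain ⟨i, hi, -, rfl⟩ := mem_vSet.1 ha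
    obtain ⟨j, hj, -, rfl⟩ := mem_vSet.1 hb
    rw [collapse_natCast, collapse_natCast] at hab
    norm_cast at hab hlt ⊢
    split_ifs at hab <;> omega

theorem collapsesAt_botMap (m : ℕ) : CollapsesAt (vSet m) botMap 1 := by
  constructor
  · norm_num [botMap]
  · intro a ha b hb hab hlt
    obtain ⟨i, hi, -, rfl⟩ := mem_vSet.1 ha
    obtain ⟨j, hj, -, rfl⟩ := mem_vSet.1 hb
    unfold botMap at hab
    norm_cast at hab hlt ⊢
    split_ifs at hab <;> omega

theorem contractTri_congr {V : Finset ℚ} {n : ℕ} {T : Finset (Finset ℚ)} {f g : ℚ → ℚ}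
    (hT : ∀ S ∈ T, S ⊆ V) (hfg : ∀ a ∈ V, f a = g a) : contractTri f n T = contractTri g n T := by
  unfold contractTri
  congr 1
  exact Finset.image_congr fun S hS => Finset.image_congr fun a ha => hfg a (hT S hS ha)

theorem contractTri_image (f g : ℚ → ℚ) (n : ℕ) (T : Finset (Finset ℚ)) :
    contractTri f n (T.image fun S => S.image g) = contractTri (f ∘ g) n T := by
  simp only [contractTri, Finset.image_image, Function.comp_def]

theorem midMap_relabel_natCast (v i : ℕ) : midMap v (relabel v i) = collapse v i := by
  have no_third : ∀ k : ℤ, (k : ℚ) ≠ 1 / 3 := by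
    intro k hk
    have h3 : (3 * k : ℚ) = 1 := by linarith
    norm_cast at h3
    omega
  have fixed : ∀ j : ℤ, midMap v (j : ℚ) = j := by
    intro j
    unfold midMap xOf yOf
    rw [if_neg]
    rintro (h | h)
    · refine no_third (v - j) ?_
      push_cast
      linarith
    · refine no_third (j - v) ?_
      push_cast
      linarith
  rw [collapse_natCast]
  unfold relabel
  rcases lt_trichotomy i v with h | h | h
  · rw [if_pos (by exact_mod_cast h), if_pos h.le]
    exact_mod_cast fixed i
  · subst h
    simp [midMap]
  · rw [if_neg (by exact_mod_cast h.not_gt), if_neg (by exact_mod_cast h.ne'), if_neg h.not_ge]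
    split_ifs with h1
    · norm_cast at h1
      subst h1
      simp [midMap]
    · have := fixed ((i : ℤ) - 1)
      push_cast at this
      rw [this, Nat.cast_sub (by omega), Nat.cast_one]

theorem topMap_natCast {m i : ℕ} (hm : 1 ≤ m) (hi : i ≤ m) :
    topMap m i = collapse (m - 1) i := by
  rw [collapse_natCast]
  unfold topMap
  split_ifs with h1 h2 h2
  · norm_cast at h1
    omega
  · norm_cast at h1
    subst h1
    rw [Nat.cast_sub hm, Nat.cast_one]
  · rfl
  · norm_cast at h1
    omega

theorem sort_image_of_monotone {c : ℚ → ℚ} (hc : Monotone c) {A : Finset ℚ}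
    (hA : Set.InjOn c A) : (A.image c).sort (· ≤ ·) = (A.sort (· ≤ ·)).map c := by
  have hp : ((A.sort (· ≤ ·)).map c).Pairwise (· < ·) := by
    rw [List.pairwise_map]
    refine (A.sortedLT_sort).pairwise.imp_of_mem fun {a b} ha hb hab => ?_
    refine (hc hab.le).lt_of_ne fun h => hab.ne (hA ?_ ?_ h)
    · simpa using ha
    · simpa using hb
  rw [← sort_toFinset_of_pairwise_lt hp]
  congr 1
  ext x
  simp

theorem AltChain.of_map {c : ℚ → ℚ} (hc : Monotone c) (l₁ l₂ : List ℚ)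
    (h : AltChain (l₁.map c) (l₂.map c)) : AltChain l₁ l₂ := by
  induction l₁, l₂ using AltChain.induct with
  | case1 => simp [AltChain]
  | case2 => simp [AltChain] at h
  | case3 => simp [AltChain]
  | case4 => simp [AltChain] at h
  | case5 a as b bs ih =>
    simp only [List.map_cons, AltChain] at h ⊢
    exact ⟨hc.reflect_lt h.1, ih (by simpa using h.2)⟩

/-- The parity condition shared by upper and lower facets. -/
def HasGapParity (V : Finset ℚ) (F : Finset ℚ) (p : ℕ) : Prop :=
  ∀ w ∈ V \ F, (F.filter fun x => w < x).card % 2 = p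

theorem isFacet_iff {V : Finset ℚ} {n : ℕ} {F : Finset ℚ} :
    IsFacet V n F ↔ F ⊆ V ∧ F.card = n ∧ ∃ p < 2, HasGapParity V F p := by
  simp only [IsFacet, IsUpperFacet, IsLowerFacet, HasGapParity, Nat.odd_iff, Nat.even_iff]
  constructor
  · rintro (⟨h1, h2, h3⟩ | ⟨h1, h2, h3⟩)
    · exact ⟨h1, h2, 1, by norm_num, h3⟩
    · exact ⟨h1, h2, 0, by norm_num, h3⟩
  · rintro ⟨h1, h2, p, hp, h3⟩
    interval_cases p
    · exact Or.inr ⟨h1, h2, h3⟩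
    · exact Or.inl ⟨h1, h2, h3⟩

/-- Adding one more vertex to a set `G` whose gap parity flips at `v`, and choosing it to be a gap
nearest to `v`, makes the gap parity constant. -/
theorem exists_insert_hasGapParity {V G : Finset ℚ} {v : ℚ} {p : ℕ} (hv : v ∈ G)
    (hne : (V \ G).Nonempty)
    (hlow : ∀ w ∈ V \ G, w < v → ((G.filter fun x => w < x).card + 1) % 2 = p)
    (hhigh : ∀ w ∈ V \ G, v < w → (G.filter fun x => w < x).card % 2 = p) :
    ∃ u ∈ V \ G, HasGapParity V (insert u G) p := by
  have count : ∀ u ∈ V \ G, ∀ w, ((insert u G).filter fun x => w < x).card =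
      (G.filter fun x => w < x).card + if w < u then 1 else 0 := by
    intro u hu w
    rw [Finset.filter_insert]
    split_ifs with h
    · rw [Finset.card_insert_of_notMem]
      simp [(Finset.mem_sdiff.1 hu).2]
    · rfl
  have ne_v : ∀ w ∈ V \ G, w ≠ v := fun w hw e => (Finset.mem_sdiff.1 hw).2 (e ▸ hv)
  obtain ⟨u, hu, hu'⟩ : ∃ u ∈ V \ G, ∀ w ∈ V \ G, w ≠ u → (w < u ↔ w < v) := by
    by_cases hL : ((V \ G).filter fun w => w < v).Nonempty
    · obtain ⟨u, hu, hmax⟩ := Finset.exists_max_image _ id hL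
      rw [Finset.mem_filter] at hu
      refine ⟨u, hu.1, fun w hw hwu => ⟨fun h => h.trans hu.2, fun h => ?_⟩⟩
      exact (hmax w (Finset.mem_filter.2 ⟨hw, h⟩)).lt_of_ne hwu
    · obtain ⟨u, hu, hmin⟩ := Finset.exists_min_image _ id hne
      refine ⟨u, hu, fun w hw hwu => ⟨fun h => absurd h (hmin w hw).not_gt, fun h => ?_⟩⟩
      exact absurd ⟨w, Finset.mem_filter.2 ⟨hw, h⟩⟩ hL
  refine ⟨u, hu, fun w hw => ?_⟩
  rw [Finset.mem_sdiff, Finset.mem_insert, not_or] at hw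
  have hwG : w ∈ V \ G := Finset.mem_sdiff.2 ⟨hw.1, hw.2.2⟩
  rw [count u hu w]
  rcases lt_or_gt_of_ne (ne_v w hwG) with h | h
  · rw [if_pos ((hu' w hwG hw.2.1).2 h)]
    exact hlow w hwG h
  · rw [if_neg fun h' => h.not_gt ((hu' w hwG hw.2.1).1 h')]
    exact hhigh w hwG h

theorem collapse_mem_vSet {m v : ℕ} (hv : 1 ≤ v) (hvm : v + 1 ≤ m) {a : ℚ} (ha : a ∈ vSet m) :
    collapse v a ∈ vSet (m - 1) := by
  obtain ⟨i, h1, h2, rfl⟩ := mem_vSet.1 ha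
  rw [collapse_natCast, mem_vSet]
  refine ⟨_, ?_, ?_, rfl⟩ <;> split_ifs <;> omega

theorem exists_collapse_eq {m v : ℕ} {w : ℚ} (hw : w ∈ vSet (m - 1)) :
    ∃ a ∈ vSet m, collapse v a = w := by
  obtain ⟨i, h1, h2, rfl⟩ := mem_vSet.1 hw
  by_cases hi : i ≤ v
  · exact ⟨i, mem_vSet.2 ⟨i, h1, by omega, rfl⟩, by rw [collapse_natCast, if_pos hi]⟩
  · refine ⟨(i + 1 : ℕ), mem_vSet.2 ⟨i + 1, by omega, by omega, rfl⟩, ?_⟩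
    rw [collapse_natCast, if_neg (by omega)]
    simp

/-- Every facet is mapped into a facet by a contraction of an edge of consecutive vertices. -/
theorem exists_facet_of_collapse {m n v : ℕ} (hn : n < m) (hv : 1 ≤ v) (hvm : v + 1 ≤ m)
    {F : Finset ℚ} (hF : IsFacet (vSet m) n F) :
    ∃ G, IsFacet (vSet (m - 1)) n G ∧ F.image (collapse v) ⊆ G := by
  obtain ⟨hFV, hFc, p, hp, hpar⟩ := isFacet_iff.1 hF
  have hcol := collapsesAt_collapse m v
  have hmono := collapse_mono v
  have himV : F.image (collapse v) ⊆ vSet (m - 1) := by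
    intro w hw
    obtain ⟨a, ha, rfl⟩ := Finset.mem_image.1 hw
    exact collapse_mem_vSet hv hvm (hFV ha)
  have hfilter : ∀ a, collapse v a ∉ F.image (collapse v) →
      (F.image (collapse v)).filter (fun x => collapse v a < x) =
        (F.filter fun x => a < x).image (collapse v) := by
    intro a ha
    rw [Finset.filter_image]
    congr 1
    refine Finset.filter_congr fun x hx => ⟨hmono.reflect_lt, fun h => ?_⟩
    exact (hmono h.le).lt_of_ne fun e => ha (e ▸ Finset.mem_image_of_mem _ hx)
  have hgap : ∀ w ∈ vSet (m - 1) \ F.image (collapse v), ∃ a ∈ vSet m \ F, collapse v a = w := by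
    intro w hw
    obtain ⟨hwV, hwF⟩ := Finset.mem_sdiff.1 hw
    obtain ⟨a, ha, rfl⟩ := exists_collapse_eq (v := v) hwV
    exact ⟨a, Finset.mem_sdiff.2 ⟨ha, fun h => hwF (Finset.mem_image_of_mem _ h)⟩, rfl⟩
  by_cases hboth : (v : ℚ) ∈ F ∧ (v : ℚ) + 1 ∈ F
  · have hcv : collapse v v = v := by simp [collapse]
    have himE : (F.erase ((v : ℚ) + 1)).image (collapse v) = F.image (collapse v) := by
      refine (Finset.image_subset_image (Finset.erase_subset _ _)).antisymm fun w hw => ?_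
      obtain ⟨a, ha, rfl⟩ := Finset.mem_image.1 hw
      by_cases e : a = (v : ℚ) + 1
      · rw [e, ← hcol.1]
        exact Finset.mem_image_of_mem _ (Finset.mem_erase.2 ⟨by simp, hboth.1⟩)
      · exact Finset.mem_image_of_mem _ (Finset.mem_erase.2 ⟨e, ha⟩)
    have hinjE : Set.InjOn (collapse v) (F.erase ((v : ℚ) + 1)) :=
      hcol.injOn ((Finset.erase_subset _ _).trans hFV) (Or.inr (Finset.notMem_erase _ _))
    have himc : (F.image (collapse v)).card + 1 = n := by
      rw [← himE, Finset.card_image_of_injOn hinjE, Finset.card_erase_add_one hboth.2, hFc]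
    have hvG : (v : ℚ) ∈ F.image (collapse v) := Finset.mem_image.2 ⟨v, hboth.1, hcv⟩
    obtain ⟨u, hu, hpu⟩ := exists_insert_hasGapParity (V := vSet (m - 1))
      (G := F.image (collapse v)) hvG (by
        rw [← Finset.card_pos, Finset.card_sdiff_of_subset himV, card_vSet]
        omega) (by
        intro w hw hwv
        obtain ⟨a, ha, rfl⟩ := hgap w hw
        have hav : a < v + 1 := by
          refine (hmono.reflect_lt (b := (v : ℚ) + 1) ?_)
          rwa [← hcol.1, hcv]
        rw [hfilter a (Finset.mem_sdiff.1 hw).2]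
        have hE : (F.filter fun x => a < x).image (collapse v) =
            ((F.filter fun x => a < x).erase ((v : ℚ) + 1)).image (collapse v) := by
          rw [← Finset.filter_erase]
          have h1 := hfilter a (Finset.mem_sdiff.1 hw).2
          rw [← h1, ← himE, Finset.filter_image]
          congr 1
          refine Finset.filter_congr fun x hx => ⟨hmono.reflect_lt, fun h => ?_⟩
          exact (hmono h.le).lt_of_ne fun e =>
            (Finset.mem_sdiff.1 hw).2 (e ▸ Finset.mem_image_of_mem _ (Finset.mem_of_mem_erase hx))
        rw [hE, Finset.card_image_of_injOn (hinjE.mono (by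
          exact_mod_cast Finset.erase_subset_erase _ (Finset.filter_subset _ _))),
          Finset.card_erase_add_one (by simp [hboth.2, hav])]
        exact hpar a ha) (by
        intro w hw hvw
        obtain ⟨a, ha, rfl⟩ := hgap w hw
        have hav : (v : ℚ) + 1 < a := by
          refine (hmono.reflect_lt (a := (v : ℚ) + 1) ?_)
          rwa [← hcol.1, hcv]
        rw [hfilter a (Finset.mem_sdiff.1 hw).2, Finset.card_image_of_injOn]
        · exact hpar a ha
        · refine hcol.injOn ((Finset.filter_subset _ _).trans hFV) (Or.inr ?_)
          simp [hav.le])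
    obtain ⟨huV, huG⟩ := Finset.mem_sdiff.1 hu
    exact ⟨insert u (F.image (collapse v)), isFacet_iff.2 ⟨Finset.insert_subset huV himV,
      by rw [Finset.card_insert_of_notMem huG, himc], p, hp, hpu⟩, Finset.subset_insert _ _⟩
  · have hinj : Set.InjOn (collapse v) F := hcol.injOn hFV (by tauto)
    refine ⟨_, isFacet_iff.2 ⟨himV, by rw [Finset.card_image_of_injOn hinj, hFc], p, hp, ?_⟩,
      subset_rfl⟩
    intro w hw
    obtain ⟨a, ha, rfl⟩ := hgap w hw
    rw [hfilter a (Finset.mem_sdiff.1 hw).2,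
      Finset.card_image_of_injOn (hinj.mono (by exact_mod_cast Finset.filter_subset _ _))]
    exact hpar a ha

/-- An internal simplex of a contraction lifts to an internal simplex. -/
theorem exists_internalSimps_lift {m n v : ℕ} (hn : n < m) (hv : 1 ≤ v) (hvm : v + 1 ≤ m)
    {T : Finset (Finset ℚ)} (hT : ∀ S ∈ T, S ⊆ vSet m ∧ S.card = n + 1) {A : Finset ℚ}
    (hA : A ∈ internalSimps (vSet (m - 1)) n (contractTri (collapse v) n T)) :
    ∃ A' ∈ internalSimps (vSet m) n T, A'.image (collapse v) = A ∧
      Set.InjOn (collapse v) A' := by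
  simp only [internalSimps, contractTri, Finset.mem_filter, Finset.mem_image,
    Finset.mem_powerset] at hA
  obtain ⟨-, hAc, ⟨-, ⟨⟨S, hS, rfl⟩, hSc⟩, hAS⟩, hAint⟩ := hA
  obtain ⟨hSV, hSc'⟩ := hT S hS
  have hinj : Set.InjOn (collapse v) S := Finset.card_image_iff.1 (hSc.trans hSc'.symm)
  have him : (S.filter fun s => collapse v s ∈ A).image (collapse v) = A := by
    ext a
    simp only [Finset.mem_image, Finset.mem_filter]
    constructor
    · rintro ⟨s, ⟨-, hs⟩, rfl⟩
      exact hs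
    · intro ha
      obtain ⟨s, hs, rfl⟩ := Finset.mem_image.1 (hAS ha)
      exact ⟨s, ⟨hs, ha⟩, rfl⟩
  have hinj' : Set.InjOn (collapse v) (S.filter fun s => collapse v s ∈ A) :=
    hinj.mono (by exact_mod_cast Finset.filter_subset _ _)
  refine ⟨_, ?_, him, hinj'⟩
  simp only [internalSimps, Finset.mem_filter, Finset.mem_powerset]
  refine ⟨(Finset.filter_subset _ _).trans hSV, ?_, ⟨S, hS, Finset.filter_subset _ _⟩, ?_⟩
  · rw [← Finset.card_image_of_injOn hinj', him, hAc]
  · intro F hF hsub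
    obtain ⟨G, hG, hFG⟩ := exists_facet_of_collapse hn hv hvm hF
    refine hAint G hG (Finset.Subset.trans ?_ hFG)
    rw [← him]
    exact Finset.image_subset_image hsub

theorem Wr.of_image {c : ℚ → ℚ} (hc : Monotone c) {A B : Finset ℚ} (hA : Set.InjOn c A)
    (hB : Set.InjOn c B) (h : Wr (A.image c) (B.image c)) : Wr A B := by
  unfold Wr Intertwines at h ⊢
  rw [sort_image_of_monotone hc hA, sort_image_of_monotone hc hB, Finset.card_image_of_injOn hA,
    Finset.card_image_of_injOn hB] at h
  split_ifs at h ⊢ <;> exact AltChain.of_map hc _ _ h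

theorem Le2Even.contractTri_collapse {m d v : ℕ} (hm : 2 * d < m) (hv : 1 ≤ v) (hvm : v + 1 ≤ m)
    {T T' : Finset (Finset ℚ)} (hT : ∀ S ∈ T, S ⊆ vSet m ∧ S.card = 2 * d + 1)
    (hT' : ∀ S ∈ T', S ⊆ vSet m ∧ S.card = 2 * d + 1) (hle : Le2Even (vSet m) d T T') :
    Le2Even (vSet (m - 1)) d (contractTri (collapse v) (2 * d) T)
      (contractTri (collapse v) (2 * d) T') := by
  intro A hA B hB hBA
  obtain ⟨A', hA', rfl, hiA⟩ := exists_internalSimps_lift hm hv hvm hT hA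
  obtain ⟨B', hB', rfl, hiB⟩ := exists_internalSimps_lift hm hv hvm hT' hB
  exact hle A' hA' B' hB' (hBA.of_image (collapse_mono v) hiB hiA)

/-- **Corollary.** If `m > 2d + 3`, `T <₂ T'` and the contractions at both ends agree,
then there is a middle vertex `v ∈ [3, m - 2]` at which the contractions of the relabelled
triangulations remain strictly related in the second order. -/
theorem even_contraction_vertices_cor (m d : ℕ) (hd : 1 ≤ d) (hm : 2 * d + 3 < m)
    (T T' : Finset (Finset ℚ))
    (hT : IsTriangulation (vSet m) (2 * d) T)
    (hT' : IsTriangulation (vSet m) (2 * d) T')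
    (hle : Le2Even (vSet m) d T T') (hne : T ≠ T')
    (hbot : contractTri botMap (2 * d) T = contractTri botMap (2 * d) T')
    (htop : contractTri (topMap (m : ℚ)) (2 * d) T = contractTri (topMap (m : ℚ)) (2 * d) T') :
    ∃ v : ℕ, 3 ≤ v ∧ v ≤ m - 2 ∧
      Le2Even (vSet (m - 1)) d
        (contractTri (midMap v) (2 * d) (T.image fun S => S.image (relabel v)))
        (contractTri (midMap v) (2 * d) (T'.image fun S => S.image (relabel v))) ∧
      contractTri (midMap v) (2 * d) (T.image fun S => S.image (relabel v)) ≠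
        contractTri (midMap v) (2 * d) (T'.image fun S => S.image (relabel v)) := by
  have hmid : ∀ v, ∀ T₀, IsTriangulation (vSet m) (2 * d) T₀ →
      contractTri (midMap v) (2 * d) (T₀.image fun S => S.image (relabel v)) =
        contractTri (collapse v) (2 * d) T₀ := by
    intro v T₀ h₀
    rw [contractTri_image]
    refine contractTri_congr (fun S hS => (h₀.1 S hS).1) fun a ha => ?_
    obtain ⟨i, -, -, rfl⟩ := mem_vSet.1 ha
    exact midMap_relabel_natCast v i
  have htop' : ∀ T₀, IsTriangulation (vSet m) (2 * d) T₀ →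
      contractTri (topMap (m : ℚ)) (2 * d) T₀ = contractTri (collapse (m - 1)) (2 * d) T₀ := by
    intro T₀ h₀
    refine contractTri_congr (fun S hS => (h₀.1 S hS).1) fun a ha => ?_
    obtain ⟨i, -, hi, rfl⟩ := mem_vSet.1 ha
    exact topMap_natCast (by omega) hi
  by_contra hcon
  have heq : ∀ v, 3 ≤ v → v < m →
      contractTri (collapse v) (2 * d) T = contractTri (collapse v) (2 * d) T' := by
    intro v hv hvm
    rcases Nat.lt_or_ge (m - 2) v with h | h
    · obtain rfl : v = m - 1 := by omega
      rw [← htop' T hT, ← htop' T' hT', htop]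
    · by_contra hv_ne
      refine hcon ⟨v, hv, h, ?_, ?_⟩
      · rw [hmid v T hT, hmid v T' hT']
        exact hle.contractTri_collapse (by omega) (by omega) (by omega) hT.1 hT'.1
      · rwa [hmid v T hT, hmid v T' hT']
  have hf : ∀ h, 3 ≤ h → h < m → CollapsesAt (vSet m) (collapse h) h := fun h _ _ =>
    collapsesAt_collapse m h
  exact hne ((subset_of_contractTri_eq hm hf (collapsesAt_botMap m) hT hT' heq hbot).antisymm
    (subset_of_contractTri_eq hm hf (collapsesAt_botMap m) hT' hT
      (fun h h3 hlt => (heq h h3 hlt).symm) hbot.symm))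

end HST
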